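/- Let Ω ⊂ ℝⁿ be a bounded domain with a tree-covering {U_t}_{t∈Γ} obtained from a Whitney decomposition (U_t = (17/16)·int(Q_t)). Let p(·) be an exponent function with 1 < p_- ≤ p_+ < ∞ and p(·) ∈ ∂LH_0^τ(Ω) for some τ ≥ 1, and let p'(·) be the pointwise dual exponent (1/p(x) + 1/p'(x) = 1). Then there is a constant C such that for every f ∈ L^{p(·)}(Ω) and every g ∈ L^{p'(·)}(Ω), Σ_{t∈Γ} ‖χ_{U_t} f‖_{L^{p(·)}(Ω)} ‖χ_{U_t} g‖_{L^{p'(·)}(Ω)} ≤ C ‖f‖_{L^{p(·)}(Ω)} ‖g‖_{L^{p'(·)}(Ω)}. -/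

import Mathlib

open MeasureTheory Metric Set Filter Topology

noncomputable section

abbrev Eucl (n : ℕ) : Type := EuclideanSpace ℝ (Fin n)

/-- Essential supremum of `p` over the set `A` (w.r.t. Lebesgue measure). -/
def essSupOn {n : ℕ} (p : Eucl n → ℝ) (A : Set (Eucl n)) : ℝ :=
  essSup p (volume.restrict A)

/-- Essential infimum of `p` over the set `A` (w.r.t. Lebesgue measure). -/
def essInfOn {n : ℕ} (p : Eucl n → ℝ) (A : Set (Eucl n)) : ℝ :=
  essInf p (volume.restrict A)

/-- The Luxemburg norm of `f` on `A` with variable exponent `p`. -/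
def luxNorm {n : ℕ} (A : Set (Eucl n)) (p f : Eucl n → ℝ) : ℝ :=
  sInf {l : ℝ | 0 < l ∧ (∫⁻ x in A, ENNReal.ofReal ((|f x| / l) ^ (p x))) ≤ 1}

/-- `f` belongs to the variable Lebesgue space `L^{p(·)}(A)`. -/
def MemVarLp {n : ℕ} (A : Set (Eucl n)) (p f : Eucl n → ℝ) : Prop :=
  ∃ l : ℝ, 0 < l ∧ (∫⁻ x in A, ENNReal.ofReal ((|f x| / l) ^ (p x))) ≤ 1

/-- `d(x) = dist(x, ∂Ω)`. -/
def bdist {n : ℕ} (Ω : Set (Eucl n)) (x : Eucl n) : ℝ :=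
  infDist x (frontier Ω)

/-- The ball `B_{x,τ} = B(x, τ d(x))`. -/
def ballB {n : ℕ} (Ω : Set (Eucl n)) (τ : ℝ) (x : Eucl n) : Set (Eucl n) :=
  ball x (τ * bdist Ω x)

/-- The boundary log-Hölder condition `∂LH₀^τ(Ω)` with constant `C₀`. -/
def BoundaryLH {n : ℕ} (Ω : Set (Eucl n)) (p : Eucl n → ℝ) (τ C₀ : ℝ) : Prop :=
  ∀ x ∈ Ω, τ * bdist Ω x ≤ 1 / 2 →
    essSupOn p (ballB Ω τ x ∩ Ω) - essInfOn p (ballB Ω τ x ∩ Ω)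
      ≤ C₀ / (-Real.log (τ * bdist Ω x))

/-- `Ω` is a John domain with parameter `lam`. -/
def JohnDomain {n : ℕ} (Ω : Set (Eucl n)) (lam : ℝ) : Prop :=
  ∃ x₀ ∈ Ω, ∀ y ∈ Ω, ∃ ℓ : ℝ, 0 ≤ ℓ ∧ ∃ γ : ℝ → Eucl n,
    γ 0 = y ∧ γ ℓ = x₀ ∧ (∀ t ∈ Icc (0:ℝ) ℓ, γ t ∈ Ω) ∧
    LipschitzOnWith 1 γ (Icc (0:ℝ) ℓ) ∧
    ∀ t ∈ Icc (0:ℝ) ℓ, t ≤ lam * infDist (γ t) (frontier Ω)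

/-- `g` is uniformly `ε`-continuous on `S`. -/
def UnifEpsCont {n : ℕ} (S : Set (Eucl n)) (g : Eucl n → ℝ) (ε : ℝ) : Prop :=
  ∃ δ : ℝ, 0 < δ ∧ ∀ x ∈ S, ∀ y ∈ S, dist x y < δ → |g y - g x| < ε

/-- `f` is locally Lipschitz on `S`. -/
def LocLipschitzOn {n : ℕ} (S : Set (Eucl n)) (f : Eucl n → ℝ) : Prop :=
  ∀ x ∈ S, ∃ K : NNReal, ∃ t ∈ 𝓝 x, LipschitzOnWith K f (t ∩ S)

/-- The average of `f` over `A`. -/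
def avgOn {n : ℕ} (A : Set (Eucl n)) (f : Eucl n → ℝ) : ℝ :=
  (volume A).toReal⁻¹ * ∫ x in A, f x

/-- The pointwise dual (conjugate) exponent `p'`, `1/p + 1/p' = 1`. -/
def dualExp {α : Type*} (p : α → ℝ) : α → ℝ :=
  fun x => p x / (p x - 1)

/-- The norm of the a.e.-defined gradient of `f`. -/
def gradNorm {n : ℕ} (f : Eucl n → ℝ) : Eucl n → ℝ :=
  fun x => ‖fderiv ℝ f x‖

/-- The closed dyadic cube of generation `k` with lattice coordinates `z`. -/
def cubeQ {n : ℕ} (k : ℤ) (z : Fin n → ℤ) : Set (Eucl n) :=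
  {x | ∀ i, |x i - ((z i : ℝ) + 1 / 2) * (2:ℝ) ^ (-k)| ≤ (2:ℝ) ^ (-k) / 2}

/-- The expanded open cube `U = (17/16)·int(Q)`. -/
def cubeU {n : ℕ} (k : ℤ) (z : Fin n → ℤ) : Set (Eucl n) :=
  {x | ∀ i, |x i - ((z i : ℝ) + 1 / 2) * (2:ℝ) ^ (-k)| < (17 / 16) * ((2:ℝ) ^ (-k) / 2)}

/-- The dilation `K·Q` of the cube `Q` about its center. -/
def cubeDil {n : ℕ} (K : ℝ) (k : ℤ) (z : Fin n → ℤ) : Set (Eucl n) :=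
  {x | ∀ i, |x i - ((z i : ℝ) + 1 / 2) * (2:ℝ) ^ (-k)| ≤ K * ((2:ℝ) ^ (-k) / 2)}

/-- Distance between two sets. -/
def setDist {n : ℕ} (A B : Set (Eucl n)) : ℝ :=
  sInf (Set.image2 dist A B)

/-- A tree-covering of a bounded domain `Ω` obtained from a Whitney decomposition,
with `U_t = (17/16)·int(Q_t)` (Remark 3.2). -/
structure WhitneyTreeCovering (n : ℕ) (Ω : Set (Eucl n)) where
  ι : Type
  countable : Countable ι
  kk : ι → ℤ
  zz : ι → Fin n → ℤ
  disjQ : ∀ s t : ι, s ≠ t →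
    Disjoint (interior (cubeQ (kk s) (zz s))) (interior (cubeQ (kk t) (zz t)))
  unionQ : (⋃ t : ι, cubeQ (kk t) (zz t)) = Ω
  whitney₁ : ∀ t, Metric.diam (cubeQ (kk t) (zz t))
    ≤ setDist (cubeQ (kk t) (zz t)) (frontier Ω)
  whitney₂ : ∀ t, setDist (cubeQ (kk t) (zz t)) (frontier Ω)
    ≤ 4 * Metric.diam (cubeQ (kk t) (zz t))
  neighbor : ∀ s t : ι, (cubeQ (kk s) (zz s) ∩ cubeQ (kk t) (zz t)).Nonempty →
    Metric.diam (cubeQ (kk t) (zz t)) ≤ 4 * Metric.diam (cubeQ (kk s) (zz s))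
  root : ι
  parent : ι → ι
  parent_root : parent root = root
  reach : ∀ t : ι, ∃ m : ℕ, parent^[m] t = root
  C₁ : ℝ
  one_le_C₁ : 1 ≤ C₁
  cover : ∀ᵐ x ∂(volume : Measure (Eucl n)),
    (x ∈ Ω → 1 ≤ ∑' t : ι, Set.indicator (cubeU (kk t) (zz t)) (fun _ => (1:ℝ)) x) ∧
    (∑' t : ι, Set.indicator (cubeU (kk t) (zz t)) (fun _ => (1:ℝ)) x
      ≤ C₁ * Set.indicator Ω (fun _ => (1:ℝ)) x)
  Bt : ι → Set (Eucl n)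
  Bt_open : ∀ t, IsOpen (Bt t)
  Bt_sub : ∀ t, t ≠ root → Bt t ⊆ cubeU (kk t) (zz t) ∩ cubeU (kk (parent t)) (zz (parent t))
  Bt_disj : ∀ s t, s ≠ root → t ≠ root → s ≠ t → Disjoint (Bt s) (Bt t)
  C₂ : ℝ
  meas_ratio : ∀ t, t ≠ root →
    (volume (cubeU (kk t) (zz t))).toReal ≤ C₂ * (volume (Bt t)).toReal

/-- The Whitney cube `Q_t`. -/
def WhitneyTreeCovering.Q {n : ℕ} {Ω : Set (Eucl n)} (T : WhitneyTreeCovering n Ω)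
    (t : T.ι) : Set (Eucl n) := cubeQ (T.kk t) (T.zz t)

/-- The expanded cube `U_t`. -/
def WhitneyTreeCovering.U {n : ℕ} {Ω : Set (Eucl n)} (T : WhitneyTreeCovering n Ω)
    (t : T.ι) : Set (Eucl n) := cubeU (T.kk t) (T.zz t)

/-- The shadow `W_t = ⋃_{s ⪰ t} U_s`. -/
def WhitneyTreeCovering.shadow {n : ℕ} {Ω : Set (Eucl n)} (T : WhitneyTreeCovering n Ω)
    (t : T.ι) : Set (Eucl n) :=
  ⋃ s ∈ {s : T.ι | ∃ m : ℕ, T.parent^[m] s = t}, T.U s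

/-- The characteristic function of a set, as a real valued function. -/
def charFun {n : ℕ} (A : Set (Eucl n)) : Eucl n → ℝ :=
  Set.indicator A (fun _ => (1:ℝ))

/-- The center of the dyadic cube `cubeQ k z`. -/
def cubeCenter {n : ℕ} (k : ℤ) (z : Fin n → ℤ) : Eucl n :=
  WithLp.toLp 2 fun i => ((z i : ℝ) + 1 / 2) * (2:ℝ) ^ (-k)

lemma mem_cubeQ_iff {n : ℕ} {k : ℤ} {z : Fin n → ℤ} {x : Eucl n} :
    x ∈ cubeQ k z ↔ ∀ i, |x i - cubeCenter k z i| ≤ (2:ℝ) ^ (-k) / 2 := Iff.rfl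

lemma mem_cubeU_iff {n : ℕ} {k : ℤ} {z : Fin n → ℤ} {x : Eucl n} :
    x ∈ cubeU k z ↔ ∀ i, |x i - cubeCenter k z i| < (17 / 16) * ((2:ℝ) ^ (-k) / 2) := Iff.rfl

lemma cubeCenter_mem_cubeQ {n : ℕ} (k : ℤ) (z : Fin n → ℤ) :
    cubeCenter k z ∈ cubeQ k z := by
  rw [mem_cubeQ_iff]
  intro i
  simp only [sub_self, abs_zero]
  positivity

lemma cubeQ_subset_cubeU {n : ℕ} (k : ℤ) (z : Fin n → ℤ) :
    (cubeQ k z : Set (Eucl n)) ⊆ cubeU k z := by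
  intro x hx
  rw [mem_cubeQ_iff] at hx
  rw [mem_cubeU_iff]
  intro i
  have : (0:ℝ) < (2:ℝ) ^ (-k) := by positivity
  linarith [hx i]

lemma measurableSet_cubeU {n : ℕ} (k : ℤ) (z : Fin n → ℤ) :
    MeasurableSet (cubeU k z : Set (Eucl n)) := by
  have h : (cubeU k z : Set (Eucl n)) = ⋂ i, {x : Eucl n |
      |x i - ((z i : ℝ) + 1 / 2) * (2:ℝ) ^ (-k)| < (17 / 16) * ((2:ℝ) ^ (-k) / 2)} := by
    ext x
    simp [cubeU]
  rw [h]
  refine MeasurableSet.iInter fun i => ?_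
  exact measurableSet_lt (by fun_prop) measurable_const

lemma dist_le_card_mul {n : ℕ} {x y : Eucl n} {r : ℝ} (hr : 0 ≤ r)
    (h : ∀ i, |x i - y i| ≤ r) : dist x y ≤ n * r := by
  rw [EuclideanSpace.dist_eq, Real.sqrt_le_left (by positivity)]
  calc ∑ i, dist (x i) (y i) ^ 2 ≤ ∑ _i : Fin n, r ^ 2 := by
        refine Finset.sum_le_sum fun i _ => ?_
        rw [Real.dist_eq]
        exact pow_le_pow_left₀ (abs_nonneg _) (h i) 2
    _ = n * r ^ 2 := by simp
    _ ≤ (n * r) ^ 2 := by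
        rw [mul_pow]
        refine mul_le_mul_of_nonneg_right ?_ (sq_nonneg r)
        exact_mod_cast Nat.le_self_pow two_ne_zero n

lemma dist_le_of_mem_cubeQ {n : ℕ} {k : ℤ} {z : Fin n → ℤ} {x y : Eucl n}
    (hx : x ∈ cubeQ k z) (hy : y ∈ cubeQ k z) : dist x y ≤ n * (2:ℝ) ^ (-k) := by
  refine dist_le_card_mul (by positivity) fun i => ?_
  have h1 := abs_le.1 (mem_cubeQ_iff.1 hx i)
  have h2 := abs_le.1 (mem_cubeQ_iff.1 hy i)
  rw [abs_le]
  constructor <;> linarith [h1.1, h1.2, h2.1, h2.2]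

lemma isBounded_cubeQ {n : ℕ} (k : ℤ) (z : Fin n → ℤ) :
    Bornology.IsBounded (cubeQ k z : Set (Eucl n)) :=
  Metric.isBounded_iff.2 ⟨n * (2:ℝ) ^ (-k), fun _ hx _ hy => dist_le_of_mem_cubeQ hx hy⟩

lemma diam_cubeQ_le {n : ℕ} (k : ℤ) (z : Fin n → ℤ) :
    Metric.diam (cubeQ k z : Set (Eucl n)) ≤ n * (2:ℝ) ^ (-k) :=
  Metric.diam_le_of_forall_dist_le (by positivity) fun _ hx _ hy => dist_le_of_mem_cubeQ hx hy

lemma ball_cubeCenter_subset_cubeQ {n : ℕ} (k : ℤ) (z : Fin n → ℤ) :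
    ball (cubeCenter k z) ((2:ℝ) ^ (-k) / 2) ⊆ cubeQ k z := by
  intro x hx
  rw [mem_cubeQ_iff]
  intro i
  rw [mem_ball, dist_eq_norm] at hx
  have h := PiLp.norm_apply_le (x - cubeCenter k z) i
  rw [PiLp.sub_apply, Real.norm_eq_abs] at h
  exact h.trans hx.le

/-- Points of the expanded cube are close to the center relative to the diameter of the cube:
shrinking `x` and its reflection by `16/17` lands in the cube. -/
lemma dist_cubeCenter_le_diam {n : ℕ} {k : ℤ} {z : Fin n → ℤ} {x : Eucl n}
    (hx : x ∈ cubeU k z) : dist x (cubeCenter k z) ≤ 17 / 32 * Metric.diam (cubeQ k z) := by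
  set c : Eucl n := cubeCenter k z with hc
  rw [mem_cubeU_iff] at hx
  have hmem : ∀ e : ℝ, |e| = 16 / 17 → c + e • (x - c) ∈ cubeQ k z := by
    intro e he
    rw [mem_cubeQ_iff]
    intro i
    have : (c + e • (x - c)) i - cubeCenter k z i = e * (x i - c i) := by
      simp [hc]
    rw [this, abs_mul, he]
    linarith [hx i]
  have h1 := hmem (16 / 17) (by norm_num [abs_of_pos])
  have h2 := hmem (-(16 / 17)) (by norm_num [abs_of_pos])
  have h3 := Metric.dist_le_diam_of_mem (isBounded_cubeQ k z) h1 h2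
  have h4 : dist (c + (16 / 17 : ℝ) • (x - c)) (c + (-(16 / 17) : ℝ) • (x - c))
      = 32 / 17 * dist x c := by
    rw [dist_eq_norm, dist_eq_norm]
    have : c + (16 / 17 : ℝ) • (x - c) - (c + (-(16 / 17) : ℝ) • (x - c))
        = (32 / 17 : ℝ) • (x - c) := by
      module
    rw [this, norm_smul]
    norm_num [abs_of_pos]
  linarith [h3, h4]

lemma setDist_le_infDist {n : ℕ} {A B : Set (Eucl n)} {x : Eucl n} (hx : x ∈ A)
    (hB : B.Nonempty) : setDist A B ≤ infDist x B := by
  rw [Metric.le_infDist hB]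
  intro y hy
  exact csInf_le ⟨0, by rintro _ ⟨a, -, b, -, rfl⟩; exact dist_nonneg⟩ ⟨x, hx, y, hy, rfl⟩

lemma infDist_le_setDist_add_diam {n : ℕ} {A B : Set (Eucl n)} {x : Eucl n} (hx : x ∈ A)
    (hA : Bornology.IsBounded A) (hB : B.Nonempty) :
    infDist x B ≤ setDist A B + Metric.diam A := by
  rw [← sub_le_iff_le_add]
  obtain ⟨b, hb⟩ := hB
  refine le_csInf ⟨dist x b, x, hx, b, hb, rfl⟩ ?_
  rintro _ ⟨a, ha, b, hb, rfl⟩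
  have h1 := Metric.infDist_le_dist_of_mem (x := x) hb
  have h2 := dist_triangle x a b
  have h3 := Metric.dist_le_diam_of_mem hA hx ha
  linarith

lemma frontier_nonempty_of_isBounded {E : Type*} [NormedAddCommGroup E] [NormedSpace ℝ E]
    [Nontrivial E] {Ω : Set E} (hne : Ω.Nonempty) (hb : Bornology.IsBounded Ω) :
    (frontier Ω).Nonempty := by
  by_contra h
  rw [Set.not_nonempty_iff_eq_empty, frontier_eq_empty_iff] at h
  rcases h with rfl | rfl
  · exact Set.not_nonempty_empty hne
  · exact NormedSpace.unbounded_univ ℝ E hb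

lemma WhitneyTreeCovering.Q_subset {n : ℕ} {Ω : Set (Eucl n)} (T : WhitneyTreeCovering n Ω)
    (t : T.ι) : T.Q t ⊆ Ω := by
  conv_rhs => rw [← T.unionQ]
  exact Set.subset_iUnion (fun t => cubeQ (T.kk t) (T.zz t)) t

/-- The center of the Whitney cube `Q_t`. -/
def WhitneyTreeCovering.center {n : ℕ} {Ω : Set (Eucl n)} (T : WhitneyTreeCovering n Ω)
    (t : T.ι) : Eucl n := cubeCenter (T.kk t) (T.zz t)

lemma WhitneyTreeCovering.center_mem {n : ℕ} {Ω : Set (Eucl n)} (T : WhitneyTreeCovering n Ω)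
    (t : T.ι) : T.center t ∈ Ω := T.Q_subset t (cubeCenter_mem_cubeQ _ _)

lemma bdist_pos {n : ℕ} {Ω : Set (Eucl n)} (hΩo : IsOpen Ω)
    (hfr : (frontier Ω).Nonempty) {x : Eucl n} (hx : x ∈ Ω) : 0 < bdist Ω x := by
  refine (isClosed_frontier.notMem_iff_infDist_pos hfr).1 fun h => ?_
  rw [hΩo.frontier_eq] at h
  exact h.2 hx

lemma WhitneyTreeCovering.U_subset_ballB {n : ℕ} {Ω : Set (Eucl n)} (hΩo : IsOpen Ω)
    (hfr : (frontier Ω).Nonempty) (T : WhitneyTreeCovering n Ω) {τ : ℝ} (hτ : 1 ≤ τ) (t : T.ι) :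
    T.U t ⊆ ballB Ω τ (T.center t) := by
  intro x hx
  have hd := bdist_pos hΩo hfr (T.center_mem t)
  have h1 := dist_cubeCenter_le_diam hx
  have h2 := (T.whitney₁ t).trans (setDist_le_infDist (cubeCenter_mem_cubeQ _ _) hfr)
  change dist x (T.center t) ≤ _ at h1
  change _ ≤ bdist Ω (T.center t) at h2
  rw [ballB, mem_ball]
  nlinarith

/-- The expanded Whitney cubes have volume comparable to a power of the distance to the
boundary. -/
lemma WhitneyTreeCovering.exists_volume_lower_bound {n : ℕ} (hn : 0 < n) {Ω : Set (Eucl n)}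
    (hfr : (frontier Ω).Nonempty) (T : WhitneyTreeCovering n Ω) :
    ∃ c : ℝ, 0 < c ∧ ∀ t, ENNReal.ofReal (c * bdist Ω (T.center t) ^ n)
      ≤ volume (T.U t ∩ Ω) := by
  set v : ℝ := (volume (ball (0 : Eucl n) 1)).toReal with hv
  have hv0 : 0 < v := ENNReal.toReal_pos (measure_ball_pos _ _ one_pos).ne' measure_ball_lt_top.ne
  have hn' : (0:ℝ) < n := by exact_mod_cast hn
  refine ⟨(1 / (10 * n)) ^ n * v, by positivity, fun t => ?_⟩
  set r : ℝ := (2:ℝ) ^ (-T.kk t) / 2 with hr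
  have hr0 : 0 < r := by positivity
  have hd : bdist Ω (T.center t) ≤ 10 * n * r := by
    have h1 := infDist_le_setDist_add_diam (cubeCenter_mem_cubeQ (T.kk t) (T.zz t))
      (isBounded_cubeQ _ _) hfr
    have h2 := T.whitney₂ t
    have h3 := diam_cubeQ_le (T.kk t) (T.zz t)
    change bdist Ω (T.center t) ≤ _ at h1
    have h4 : (2:ℝ) ^ (-T.kk t) = 2 * r := by rw [hr]; ring
    rw [h4] at h3
    linarith
  have hsub : ball (T.center t) r ⊆ T.U t ∩ Ω := fun x hx =>
    have hQ := ball_cubeCenter_subset_cubeQ (T.kk t) (T.zz t) hx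
    ⟨cubeQ_subset_cubeU _ _ hQ, T.Q_subset t hQ⟩
  refine le_trans ?_ (measure_mono hsub)
  rw [Measure.addHaar_ball_of_pos _ _ hr0, finrank_euclideanSpace_fin,
    ← ENNReal.ofReal_toReal (measure_ball_lt_top (μ := volume) (x := (0 : Eucl n)) (r := 1)).ne,
    ← ENNReal.ofReal_mul (by positivity), ← hv]
  refine ENNReal.ofReal_le_ofReal ?_
  rw [mul_right_comm, ← mul_pow]
  refine mul_le_mul_of_nonneg_right (pow_le_pow_left₀ ?_ ?_ n) hv0.le
  · exact mul_nonneg (by positivity) infDist_nonneg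
  · rw [one_div, inv_mul_le_iff₀ (by positivity)]
    exact hd

lemma WhitneyTreeCovering.tsum_setLIntegral_le {n : ℕ} {Ω : Set (Eucl n)}
    (hΩ : MeasurableSet Ω) (T : WhitneyTreeCovering n Ω) {h : Eucl n → ENNReal}
    (hh : Measurable h) :
    ∑' t, ∫⁻ x in T.U t ∩ Ω, h x ≤ ENNReal.ofReal T.C₁ * ∫⁻ x in Ω, h x := by
  have := T.countable
  have hU : ∀ t, MeasurableSet (T.U t) := fun t => measurableSet_cubeU _ _
  have h1 : ∀ t, ∫⁻ x in T.U t ∩ Ω, h x = ∫⁻ x in Ω, (T.U t).indicator h x := fun t => by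
    rw [lintegral_indicator (hU t), Measure.restrict_restrict (hU t)]
  simp_rw [h1]
  rw [← lintegral_tsum fun t => (hh.indicator (hU t)).aemeasurable,
    ← lintegral_const_mul' _ _ ENNReal.ofReal_ne_top]
  refine lintegral_mono_ae ?_
  filter_upwards [ae_restrict_of_ae T.cover, ae_restrict_mem hΩ] with x hx hxΩ
  have hone : 1 ≤ ∑' t, (T.U t).indicator (fun _ => (1:ℝ)) x := hx.1 hxΩ
  have hle := hx.2
  rw [Set.indicator_of_mem hxΩ, mul_one] at hle
  have hsum : Summable fun t => (T.U t).indicator (fun _ => (1:ℝ)) x := by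
    by_contra hns
    rw [tsum_eq_zero_of_not_summable hns] at hone
    exact absurd hone (by norm_num)
  have hnn : ∀ t, 0 ≤ (T.U t).indicator (fun _ => (1:ℝ)) x := fun t =>
    Set.indicator_nonneg (fun _ _ => zero_le_one) x
  have heq : ∀ t, (T.U t).indicator h x
      = ENNReal.ofReal ((T.U t).indicator (fun _ => (1:ℝ)) x) * h x := fun t => by
    by_cases hxt : x ∈ T.U t <;> simp [hxt]
  simp_rw [heq]
  rw [ENNReal.tsum_mul_right, ← ENNReal.ofReal_tsum_of_nonneg hnn hsum]
  gcongr
  exact hle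

lemma luxNorm_nonneg {n : ℕ} (A : Set (Eucl n)) (p f : Eucl n → ℝ) : 0 ≤ luxNorm A p f :=
  Real.sInf_nonneg fun _ hl => hl.1.le

lemma luxNorm_le {n : ℕ} {A : Set (Eucl n)} {p f : Eucl n → ℝ} {l : ℝ} (hl : 0 < l)
    (h : ∫⁻ x in A, ENNReal.ofReal ((|f x| / l) ^ p x) ≤ 1) : luxNorm A p f ≤ l :=
  csInf_le ⟨0, fun _ hl => hl.1.le⟩ ⟨hl, h⟩

lemma setLIntegral_modular_indicator {n : ℕ} {Ω U : Set (Eucl n)} (hU : MeasurableSet U)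
    {p : Eucl n → ℝ} (hp : ∀ᵐ x ∂(volume.restrict Ω), 0 < p x) (f : Eucl n → ℝ) (l : ℝ) :
    ∫⁻ x in Ω, ENNReal.ofReal ((|U.indicator f x| / l) ^ p x)
      = ∫⁻ x in U ∩ Ω, ENNReal.ofReal ((|f x| / l) ^ p x) := by
  rw [← Measure.restrict_restrict hU, ← lintegral_indicator hU]
  refine lintegral_congr_ae ?_
  filter_upwards [hp] with x hx
  by_cases hxU : x ∈ U
  · simp [hxU]
  · simp [hxU, Real.zero_rpow hx.ne']

/-- If the modular of `f / l` on `Ω` is at most one, then the local norm on `U` is controlled by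
the modular on `U`, with the largest exponent on `U`. -/
lemma ofReal_luxNorm_indicator_rpow_le {n : ℕ} {Ω U : Set (Eucl n)} (hU : MeasurableSet U)
    {p : Eucl n → ℝ} (hp : ∀ᵐ x ∂(volume.restrict Ω), 0 < p x) {P : ℝ} (hP : 0 < P)
    (hpP : ∀ᵐ x ∂(volume.restrict (U ∩ Ω)), p x ≤ P) {f : Eucl n → ℝ} {l : ℝ} (hl : 0 < l)
    (hf : ∫⁻ x in Ω, ENNReal.ofReal ((|f x| / l) ^ p x) ≤ 1) :
    luxNorm Ω p (U.indicator f) / l ≤ 1 ∧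
    ENNReal.ofReal ((luxNorm Ω p (U.indicator f) / l) ^ P)
      ≤ ∫⁻ x in U ∩ Ω, ENNReal.ofReal ((|f x| / l) ^ p x) := by
  set A := ∫⁻ x in U ∩ Ω, ENNReal.ofReal ((|f x| / l) ^ p x) with hA
  have hA1 : A ≤ 1 := (lintegral_mono_set Set.inter_subset_right).trans hf
  have hAtop : A ≠ ⊤ := ne_top_of_le_ne_top ENNReal.one_ne_top hA1
  have hscale : ∀ s : ℝ, 0 < s → s ≤ 1 → A ≤ ENNReal.ofReal (s ^ P) →
      luxNorm Ω p (U.indicator f) ≤ l * s := by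
    intro s hs hs1 hAs
    refine luxNorm_le (by positivity) ?_
    rw [setLIntegral_modular_indicator hU hp]
    calc ∫⁻ x in U ∩ Ω, ENNReal.ofReal ((|f x| / (l * s)) ^ p x)
        ≤ ∫⁻ x in U ∩ Ω, ENNReal.ofReal ((s ^ P)⁻¹) * ENNReal.ofReal ((|f x| / l) ^ p x) := by
          refine lintegral_mono_ae ?_
          filter_upwards [hpP] with x hx
          rw [← ENNReal.ofReal_mul (by positivity)]
          refine ENNReal.ofReal_le_ofReal ?_
          have : |f x| / (l * s) = s⁻¹ * (|f x| / l) := by field_simp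
          rw [this, Real.mul_rpow (by positivity) (by positivity), ← Real.inv_rpow hs.le]
          refine mul_le_mul_of_nonneg_right ?_ (by positivity)
          exact Real.rpow_le_rpow_of_exponent_le ((one_le_inv₀ hs).2 hs1) hx
      _ = ENNReal.ofReal ((s ^ P)⁻¹) * A := by
          rw [lintegral_const_mul' _ _ ENNReal.ofReal_ne_top]
      _ ≤ ENNReal.ofReal ((s ^ P)⁻¹) * ENNReal.ofReal (s ^ P) := by gcongr
      _ = 1 := by
          rw [← ENNReal.ofReal_mul (by positivity), inv_mul_cancel₀ (by positivity),
            ENNReal.ofReal_one]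
  set α := luxNorm Ω p (U.indicator f) / l with hα
  have hα0 : 0 ≤ α := div_nonneg (luxNorm_nonneg _ _ _) hl.le
  have hα1 : α ≤ 1 := by
    rw [hα, div_le_one hl]
    simpa using hscale 1 one_pos le_rfl (by simpa using hA1)
  refine ⟨hα1, ?_⟩
  by_contra hcon
  rw [not_le, ENNReal.lt_ofReal_iff_toReal_lt hAtop] at hcon
  have hpow : A.toReal ^ P⁻¹ < α := by
    have := Real.rpow_lt_rpow ENNReal.toReal_nonneg hcon (inv_pos.2 hP)
    rwa [Real.rpow_rpow_inv hα0 hP.ne'] at this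
  have hαpos : 0 < α := lt_of_le_of_lt (Real.rpow_nonneg ENNReal.toReal_nonneg _) hpow
  set s := max (A.toReal ^ P⁻¹) (α / 2) with hs
  have hs0 : 0 < s := lt_max_of_lt_right (half_pos hαpos)
  have hsα : s < α := max_lt hpow (half_lt_self hαpos)
  have hAs : A ≤ ENNReal.ofReal (s ^ P) := by
    rw [ENNReal.le_ofReal_iff_toReal_le hAtop (by positivity),
      ← Real.rpow_inv_le_iff_of_pos ENNReal.toReal_nonneg hs0.le hP]
    exact le_max_left _ _
  have h1 := hscale s hs0 (hsα.le.trans hα1) hAs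
  rw [mul_comm, ← div_le_iff₀ hl] at h1
  exact absurd h1 (not_le.2 hsα)

lemma ae_essInfOn_le_and_le_essSupOn {n : ℕ} {p : Eucl n → ℝ} {A : Set (Eucl n)} {q M : ℝ}
    (hA : volume A ≠ 0) (hq : ∀ᵐ x ∂(volume.restrict A), q ≤ p x)
    (hM : ∀ᵐ x ∂(volume.restrict A), p x ≤ M) :
    q ≤ essInfOn p A ∧
    ∀ᵐ x ∂(volume.restrict A), essInfOn p A ≤ p x ∧ p x ≤ essSupOn p A := by
  have : NeZero (volume.restrict A) := ⟨by rwa [Ne, Measure.restrict_eq_zero]⟩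
  have hbA : IsBoundedUnder (· ≤ ·) (ae (volume.restrict A)) p := ⟨M, hM⟩
  have hbB : IsBoundedUnder (· ≥ ·) (ae (volume.restrict A)) p := ⟨q, hq⟩
  refine ⟨le_essInf_of_ae_le q hq hbA.isCoboundedUnder_ge, ?_⟩
  filter_upwards [ae_essInf_le hbB, ae_le_essSup hbA] with x h1 h2
  exact ⟨h1, h2⟩

/-- A logarithmic bound on the exponent makes the corresponding negative power bounded. -/
lemma rpow_neg_le_exp_of_log_bound {n : ℕ} {c s w δ D E : ℝ} (hc : 0 < c) (hs : 0 < s)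
    (hw : c * s ^ n ≤ w) (hδ : 0 ≤ δ) (hδD : δ ≤ D) (hE : 0 ≤ E)
    (hlog : s ≤ 1 / 2 → δ ≤ E / (-Real.log s)) :
    w ^ (-δ) ≤ Real.exp (D * |Real.log c| + n * (E + D * Real.log 2)) := by
  have hD : 0 ≤ D := hδ.trans hδD
  have hcs : 0 < c * s ^ n := by positivity
  have hw0 : 0 < w := hcs.trans_le hw
  rw [Real.rpow_def_of_pos hw0, Real.exp_le_exp]
  have h1 : Real.log c + n * Real.log s ≤ Real.log w := by
    rw [← Real.log_pow, ← Real.log_mul hc.ne' (by positivity)]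
    exact Real.log_le_log hcs hw
  have hlog2 : 0 < Real.log 2 := Real.log_pos one_lt_two
  have h2 : δ * (-Real.log s) ≤ E + D * Real.log 2 := by
    rcases le_or_gt s (1 / 2) with h | h
    · have hneg : 0 < -Real.log s := neg_pos.2 (Real.log_neg hs (by linarith))
      have := (le_div_iff₀ hneg).1 (hlog h)
      have := mul_nonneg hD hlog2.le
      linarith
    · have h3 : -Real.log s ≤ Real.log 2 := by
        rw [← Real.log_inv]
        refine Real.log_le_log (by positivity) ?_
        rw [inv_le_comm₀ hs two_pos]
        linarith
      have := mul_le_mul_of_nonneg_left h3 hδ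
      have := mul_le_mul_of_nonneg_right hδD hlog2.le
      linarith
  have h3 : δ * (-Real.log c) ≤ D * |Real.log c| :=
    (mul_le_mul_of_nonneg_left (neg_le_abs _) hδ).trans
      (mul_le_mul_of_nonneg_right hδD (abs_nonneg _))
  have h4 := mul_le_mul_of_nonneg_left h2 (Nat.cast_nonneg (α := ℝ) n)
  have h5 := mul_le_mul_of_nonneg_left h1 hδ
  nlinarith

/-- Lowering the exponent costs a constant factor above the threshold `w` and at most `w` below. -/
lemma rpow_le_add_mul_rpow {b w r R K : ℝ} (hb : 0 ≤ b) (hb1 : b ≤ 1) (hw : 0 < w)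
    (hr : 1 ≤ r) (hrR : r ≤ R) (hK : w ^ (-(R - r)) ≤ K) : b ^ r ≤ w + K * b ^ R := by
  have hK0 : 0 ≤ K := (Real.rpow_nonneg hw.le _).trans hK
  rcases le_or_gt b w with h | h
  · have h1 : b ^ r ≤ b := by
      simpa using Real.rpow_le_rpow_of_exponent_ge' hb hb1 zero_le_one hr
    have : 0 ≤ K * b ^ R := by positivity
    linarith
  · have hb0 : 0 < b := hw.trans h
    have h1 : b ^ r = b ^ (-(R - r)) * b ^ R := by
      rw [← Real.rpow_add hb0]
      ring_nf
    have h2 : b ^ (-(R - r)) ≤ w ^ (-(R - r)) :=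
      Real.rpow_le_rpow_of_nonpos hw h.le (by linarith)
    rw [h1]
    have := mul_le_mul_of_nonneg_right (h2.trans hK) (Real.rpow_nonneg hb R)
    linarith

lemma le_mul_sInf_mul_sInf {S R : Set ℝ} (hS : S.Nonempty) (hR : R.Nonempty)
    (hS0 : BddBelow S) (hR0 : BddBelow R) {a C : ℝ}
    (h : ∀ l ∈ S, ∀ m ∈ R, a ≤ C * l * m) : a ≤ C * sInf S * sInf R := by
  obtain ⟨u, -, hu, huS⟩ := exists_seq_tendsto_sInf hS hS0
  obtain ⟨v, -, hv, hvR⟩ := exists_seq_tendsto_sInf hR hR0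
  exact ge_of_tendsto' ((hu.const_mul C).mul hv) fun k => h _ (huS k) _ (hvR k)

lemma tsum_le_of_tsum_ofReal_le {ι : Type*} {c : ι → ℝ} (hc : ∀ i, 0 ≤ c i) {D : ℝ} (hD : 0 ≤ D)
    (h : ∑' i, ENNReal.ofReal (c i) ≤ ENNReal.ofReal D) : ∑' i, c i ≤ D := by
  refine Real.tsum_le_of_sum_le hc fun s => ?_
  rw [← ENNReal.ofReal_le_ofReal_iff hD, ENNReal.ofReal_sum_of_nonneg fun i _ => hc i]
  exact (ENNReal.sum_le_tsum s).trans h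

lemma div_sub_one_sub_div_sub_one {a b : ℝ} (ha : 1 < a) (hb : 1 < b) :
    a / (a - 1) - b / (b - 1) = (b - a) / ((a - 1) * (b - 1)) := by
  have : a - 1 ≠ 0 := by linarith
  have : b - 1 ≠ 0 := by linarith
  field_simp
  ring

lemma div_sub_one_le_div_sub_one {a b : ℝ} (ha : 1 < a) (hab : a ≤ b) :
    b / (b - 1) ≤ a / (a - 1) := by
  rw [div_le_div_iff₀ (by linarith) (by linarith)]
  nlinarith

/-- On each expanded Whitney cube the exponent lies between two constants whose dual exponents are
so close that the corresponding power of the volume is uniformly bounded. -/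
lemma WhitneyTreeCovering.exists_local_exponents {n : ℕ} {Ω : Set (Eucl n)} (hΩo : IsOpen Ω)
    (hΩne : Ω.Nonempty) (hΩb : Bornology.IsBounded Ω) (T : WhitneyTreeCovering n Ω)
    {p : Eucl n → ℝ} {q M : ℝ} (hq1 : 1 < q) (hq : ∀ᵐ x ∂(volume.restrict Ω), q ≤ p x)
    (hM : ∀ᵐ x ∂(volume.restrict Ω), p x ≤ M) {τ C₀ : ℝ} (hτ : 1 ≤ τ) (hC₀ : 0 < C₀)
    (hLH : BoundaryLH Ω p τ C₀) :
    ∃ K : ℝ, 0 ≤ K ∧ ∀ t, ∃ a b : ℝ, 1 < a ∧ a ≤ b ∧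
      (∀ᵐ x ∂(volume.restrict (T.U t ∩ Ω)), a ≤ p x ∧ p x ≤ b) ∧
      0 < (volume (T.U t ∩ Ω)).toReal ∧
      (volume (T.U t ∩ Ω)).toReal ^ (-(a / (a - 1) - b / (b - 1))) ≤ K := by
  have hfin : ∀ t, volume (T.U t ∩ Ω) ≠ ⊤ := fun t =>
    measure_ne_top_of_subset Set.inter_subset_right hΩb.measure_lt_top.ne
  rcases Nat.eq_zero_or_pos n with rfl | hn
  · refine ⟨1, zero_le_one, fun t => ⟨p 0, p 0, ?_, le_rfl, ?_, ?_, by simp⟩⟩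
    · have : NeZero (volume.restrict Ω) :=
        ⟨by rw [Ne, Measure.restrict_eq_zero]; exact (hΩo.measure_pos volume hΩne).ne'⟩
      obtain ⟨x, hx⟩ := hq.exists
      rw [Subsingleton.elim x 0] at hx
      exact hq1.trans_le hx
    · exact Eventually.of_forall fun x => by simp [Subsingleton.elim x 0]
    · have hne : (T.U t ∩ Ω).Nonempty :=
        ⟨T.center t, cubeQ_subset_cubeU _ _ (cubeCenter_mem_cubeQ _ _), T.center_mem t⟩
      exact ENNReal.toReal_pos ((isOpen_discrete _).measure_pos volume hne).ne' (hfin t)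
  have : Nonempty (Fin n) := ⟨⟨0, hn⟩⟩
  have hfr := frontier_nonempty_of_isBounded hΩne hΩb
  obtain ⟨c, hc, hvol⟩ := T.exists_volume_lower_bound hn hfr
  have hτ0 : 0 < τ := one_pos.trans_le hτ
  have hq0 : 0 < q - 1 := sub_pos.2 hq1
  set D : ℝ := q / (q - 1) with hD
  set E : ℝ := C₀ / (q - 1) ^ 2 with hE
  refine ⟨_, (Real.exp_pos (D * |Real.log (c / τ ^ n)| + n * (E + D * Real.log 2))).le,
    fun t => ?_⟩
  set x := T.center t with hx
  set A := ballB Ω τ x ∩ Ω with hA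
  have hxΩ : x ∈ Ω := T.center_mem t
  have hd : 0 < bdist Ω x := bdist_pos hΩo hfr hxΩ
  have hAnull : volume A ≠ 0 :=
    ((isOpen_ball.inter hΩo).measure_pos volume ⟨x, mem_ball_self (by positivity), hxΩ⟩).ne'
  have hAΩ : volume.restrict A ≤ volume.restrict Ω :=
    Measure.restrict_mono_set _ Set.inter_subset_right
  obtain ⟨hqa, hae⟩ := ae_essInfOn_le_and_le_essSupOn hAnull (ae_mono hAΩ hq) (ae_mono hAΩ hM)
  have hLHx := hLH x hxΩ
  rw [← hA] at hLHx
  set a := essInfOn p A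
  set b := essSupOn p A
  have hab : a ≤ b := by
    have : NeZero (volume.restrict A) := ⟨by rwa [Ne, Measure.restrict_eq_zero]⟩
    obtain ⟨y, hy⟩ := hae.exists
    exact hy.1.trans hy.2
  have ha1 : 1 < a := hq1.trans_le hqa
  have hlow : c * bdist Ω x ^ n ≤ (volume (T.U t ∩ Ω)).toReal :=
    (ENNReal.ofReal_le_iff_le_toReal (hfin t)).1 (hvol t)
  refine ⟨a, b, ha1, hab, ae_mono (Measure.restrict_mono_set _
    (Set.inter_subset_inter_left _ (T.U_subset_ballB hΩo hfr hτ t))) hae,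
    lt_of_lt_of_le (by positivity) hlow, ?_⟩
  refine rpow_neg_le_exp_of_log_bound (s := τ * bdist Ω x) (by positivity) (by positivity) ?_
    (sub_nonneg.2 (div_sub_one_le_div_sub_one ha1 hab)) ?_ (by positivity) fun hs => ?_
  · refine le_trans (le_of_eq ?_) hlow
    rw [mul_pow]
    field_simp
  · have h1 := div_sub_one_le_div_sub_one hq1 hqa
    have h2 : 0 ≤ b / (b - 1) := div_nonneg (by linarith) (by linarith)
    linarith
  · have hneg : 0 < -Real.log (τ * bdist Ω x) :=
      neg_pos.2 (Real.log_neg (by positivity) (by linarith))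
    rw [div_sub_one_sub_div_sub_one ha1 (ha1.trans_le hab)]
    calc (b - a) / ((a - 1) * (b - 1)) ≤ (b - a) / (q - 1) ^ 2 := by
          refine div_le_div_of_nonneg_left (sub_nonneg.2 hab) (by positivity) ?_
          rw [sq]
          exact mul_le_mul (by linarith) (by linarith) hq0.le (by linarith)
      _ ≤ C₀ / (-Real.log (τ * bdist Ω x)) / (q - 1) ^ 2 := by
          gcongr
          exact hLHx hs
      _ = E / (-Real.log (τ * bdist Ω x)) := by rw [hE, div_right_comm]

/-- Lemma 4.6, a Hölder-type inequality for sums over a tree-covering. -/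
theorem holder_sum_tree
    (n : ℕ) (Ω : Set (Eucl n)) (hΩo : IsOpen Ω) (hΩc : IsConnected Ω)
    (hΩb : Bornology.IsBounded Ω) (T : WhitneyTreeCovering n Ω)
    (p : Eucl n → ℝ) (hpm : Measurable p) (hp1 : ∀ x ∈ Ω, 1 ≤ p x)
    (hpb : ∃ M : ℝ, ∀ᵐ x ∂(volume.restrict Ω), p x ≤ M)
    (hpminus : 1 < essInfOn p Ω)
    (τ : ℝ) (hτ : 1 ≤ τ) (C₀ : ℝ) (hC₀ : 0 < C₀) (hLH : BoundaryLH Ω p τ C₀) :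
    ∃ C : ℝ, ∀ f g : Eucl n → ℝ, Measurable f → Measurable g →
      MemVarLp Ω p f → MemVarLp Ω (dualExp p) g →
      (∑' t : T.ι, luxNorm Ω p (Set.indicator (T.U t) f)
          * luxNorm Ω (dualExp p) (Set.indicator (T.U t) g))
        ≤ C * luxNorm Ω p f * luxNorm Ω (dualExp p) g := by
  obtain ⟨M, hM⟩ := hpb
  have hnull : volume Ω ≠ 0 := (hΩo.measure_pos volume hΩc.nonempty).ne'
  have hq1 : ∀ᵐ x ∂(volume.restrict Ω), 1 ≤ p x := by
    filter_upwards [ae_restrict_mem hΩo.measurableSet] with x hx using hp1 x hx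
  have hq : ∀ᵐ x ∂(volume.restrict Ω), essInfOn p Ω ≤ p x := by
    filter_upwards [(ae_essInfOn_le_and_le_essSupOn hnull hq1 hM).2] with x hx using hx.1
  suffices h : ∃ C : ℝ, ∀ f g : Eucl n → ℝ, Measurable f → Measurable g →
      ∀ l : ℝ, (0 < l ∧ ∫⁻ x in Ω, ENNReal.ofReal ((|f x| / l) ^ p x) ≤ 1) →
      ∀ m : ℝ, (0 < m ∧ ∫⁻ x in Ω, ENNReal.ofReal ((|g x| / m) ^ dualExp p x) ≤ 1) →
      ∑' t : T.ι, luxNorm Ω p (Set.indicator (T.U t) f)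
        * luxNorm Ω (dualExp p) (Set.indicator (T.U t) g) ≤ C * l * m by
    obtain ⟨C, hC⟩ := h
    refine ⟨C, fun f g hf hg hfm hgm => ?_⟩
    exact le_mul_sInf_mul_sInf hfm hgm ⟨0, fun _ hl => hl.1.le⟩ ⟨0, fun _ hl => hl.1.le⟩
      (hC f g hf hg)
  have hp0 : ∀ᵐ x ∂(volume.restrict Ω), 0 < p x := by
    filter_upwards [hq1] with x hx using one_pos.trans_le hx
  have hp0' : ∀ᵐ x ∂(volume.restrict Ω), 0 < dualExp p x := by
    filter_upwards [hq] with x hx using div_pos (by linarith) (by linarith)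
  have hUm : ∀ t, MeasurableSet (T.U t) := fun t => measurableSet_cubeU _ _
  have hfin : volume Ω ≠ ⊤ := hΩb.measure_lt_top.ne
  obtain ⟨K, hK0, hK⟩ := T.exists_local_exponents hΩo hΩc.nonempty hΩb hpminus hq hM hτ hC₀ hLH
  refine ⟨T.C₁ * (1 + (volume Ω).toReal + K), fun f g hf hg l ⟨hl, hfl⟩ m ⟨hm, hgm⟩ => ?_⟩
  have hC1 : 0 ≤ T.C₁ := zero_le_one.trans T.one_le_C₁
  set α : T.ι → ℝ := fun t => luxNorm Ω p (Set.indicator (T.U t) f) / l with hα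
  set β : T.ι → ℝ := fun t => luxNorm Ω (dualExp p) (Set.indicator (T.U t) g) / m with hβ
  have hα0 : ∀ t, 0 ≤ α t := fun t => div_nonneg (luxNorm_nonneg _ _ _) hl.le
  have hβ0 : ∀ t, 0 ≤ β t := fun t => div_nonneg (luxNorm_nonneg _ _ _) hm.le
  set A : T.ι → ENNReal :=
    fun t => ∫⁻ x in T.U t ∩ Ω, ENNReal.ofReal ((|f x| / l) ^ p x) with hA
  set B : T.ι → ENNReal :=
    fun t => ∫⁻ x in T.U t ∩ Ω, ENNReal.ofReal ((|g x| / m) ^ dualExp p x) with hB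
  have hterm : ∀ t, ENNReal.ofReal (α t * β t)
      ≤ A t + (∫⁻ _ in T.U t ∩ Ω, 1) + ENNReal.ofReal K * B t := by
    intro t
    obtain ⟨a, b, ha, hab, hae, hw, hwK⟩ := hK t
    have hb : 1 < b := ha.trans_le hab
    have hwtop : volume (T.U t ∩ Ω) ≠ ⊤ := measure_ne_top_of_subset Set.inter_subset_right hfin
    have hA' := ofReal_luxNorm_indicator_rpow_le (hUm t) hp0 (one_pos.trans hb)
      (hae.mono fun x hx => hx.2) hl hfl
    have hB' := ofReal_luxNorm_indicator_rpow_le (hUm t) hp0'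
      (P := a / (a - 1)) (div_pos (by linarith) (by linarith))
      (hae.mono fun x hx => div_sub_one_le_div_sub_one ha hx.1) hm hgm
    have hconj : b.HolderConjugate (b / (b - 1)) := Real.HolderConjugate.conjExponent hb
    have hyoung : α t * β t ≤ α t ^ b + β t ^ (b / (b - 1)) := by
      refine (Real.young_inequality_of_nonneg (hα0 t) (hβ0 t) hconj).trans (add_le_add ?_ ?_)
      · exact div_le_self (Real.rpow_nonneg (hα0 t) _) hb.le
      · exact div_le_self (Real.rpow_nonneg (hβ0 t) _) hconj.symm.lt.le
    have hlower := rpow_le_add_mul_rpow (hβ0 t) hB'.1 hw hconj.symm.lt.le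
      (div_sub_one_le_div_sub_one ha hab) hwK
    calc ENNReal.ofReal (α t * β t)
        ≤ ENNReal.ofReal (α t ^ b
            + ((volume (T.U t ∩ Ω)).toReal + K * β t ^ (a / (a - 1)))) :=
          ENNReal.ofReal_le_ofReal (by linarith)
      _ = ENNReal.ofReal (α t ^ b) + (volume (T.U t ∩ Ω)
            + ENNReal.ofReal K * ENNReal.ofReal (β t ^ (a / (a - 1)))) := by
          have h1 := Real.rpow_nonneg (hα0 t) b
          have h2 := Real.rpow_nonneg (hβ0 t) (a / (a - 1))
          rw [ENNReal.ofReal_add h1 (by positivity), ENNReal.ofReal_add (by positivity)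
            (by positivity), ENNReal.ofReal_toReal hwtop, ENNReal.ofReal_mul hK0]
      _ ≤ A t + (volume (T.U t ∩ Ω) + ENNReal.ofReal K * B t) := by
          gcongr
          · exact hA'.2
          · exact hB'.2
      _ = A t + (∫⁻ _ in T.U t ∩ Ω, 1) + ENNReal.ofReal K * B t := by
          rw [setLIntegral_one, add_assoc]
  have hmeas : Measurable (dualExp p) := hpm.div (hpm.sub_const 1)
  have hsum : ∑' t, ENNReal.ofReal (α t * β t)
      ≤ ENNReal.ofReal (T.C₁ * (1 + (volume Ω).toReal + K)) := by
    refine (ENNReal.tsum_le_tsum hterm).trans ?_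
    rw [ENNReal.tsum_add, ENNReal.tsum_add, ENNReal.tsum_mul_left]
    have h1 : ∑' t, A t ≤ ENNReal.ofReal T.C₁ * 1 :=
      (T.tsum_setLIntegral_le hΩo.measurableSet (by fun_prop)).trans (by gcongr)
    have h2 : ∑' t, (∫⁻ _ in T.U t ∩ Ω, 1) ≤ ENNReal.ofReal T.C₁ * volume Ω := by
      have := T.tsum_setLIntegral_le hΩo.measurableSet (measurable_const (a := (1 : ENNReal)))
      rwa [setLIntegral_one] at this
    have h3 : ∑' t, B t ≤ ENNReal.ofReal T.C₁ * 1 :=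
      (T.tsum_setLIntegral_le hΩo.measurableSet (by fun_prop)).trans (by gcongr)
    refine (add_le_add (add_le_add h1 h2) (mul_le_mul_right h3 _)).trans (le_of_eq ?_)
    rw [ENNReal.ofReal_mul hC1, ENNReal.ofReal_add (by positivity) hK0,
      ENNReal.ofReal_add zero_le_one (by positivity), ENNReal.ofReal_toReal hfin,
      ENNReal.ofReal_one]
    ring
  have hscale : ∀ t, luxNorm Ω p (Set.indicator (T.U t) f)
      * luxNorm Ω (dualExp p) (Set.indicator (T.U t) g) = l * m * (α t * β t) := fun t => by
    simp only [hα, hβ]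
    field_simp
  simp_rw [hscale]
  rw [tsum_mul_left]
  have := mul_le_mul_of_nonneg_left (tsum_le_of_tsum_ofReal_le
    (fun t => mul_nonneg (hα0 t) (hβ0 t)) (by positivity) hsum) (mul_pos hl hm).le
  linarith
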